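/- Let M ∈ M_n(ℝ) be nonzero with M² = 0, and let A(t) = I + t·M. A twice differentiable map J : ℝ → M_n(ℝ) is a Jacobi field along A if and only if there exist real numbers b₀, b₁ and matrices K₀, K₁ ∈ M_n(ℝ) satisfying tr(K₀) = tr(K₁) = 0 and tr(K₀·M) = tr(K₁·M) = 0, such that for all t, J(t) = b(t)·((‖M‖²·t/n)·I + Mᵀ) + K₀ + t·K₁, where b(t) = (√n·b₁/‖M‖)·arctan(‖M‖·t/√n) + b₀. -/

import Mathlib

noncomputable section
open Matrix Filter

attribute [local instance] Matrix.normedAddCommGroup Matrix.normedSpace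

/-- The Hilbert–Schmidt norm of a square real matrix. -/
def hsNorm {n : ℕ} (X : Matrix (Fin n) (Fin n) ℝ) : ℝ :=
  Real.sqrt (Matrix.trace (X * Xᵀ))

/-- A Jacobi field along a linear geodesic `A` of `SL(n)`: a twice differentiable
matrix-valued map `J` that is tangent to `SL(n)` along `A` (`tr(A⁻¹J) = 0`) and
whose second derivative is everywhere a scalar multiple of `(A⁻¹)ᵀ`. -/
def IsJacobiField {n : ℕ} (A J : ℝ → Matrix (Fin n) (Fin n) ℝ) : Prop :=
  (∀ t, DifferentiableAt ℝ J t) ∧ (∀ t, DifferentiableAt ℝ (deriv J) t) ∧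
  (∀ t, Matrix.trace ((A t)⁻¹ * J t) = 0) ∧
  (∀ t, ∃ c : ℝ, deriv (deriv J) t = c • ((A t)⁻¹)ᵀ)

/-- The inverse of `I + tM` for `M² = 0`. -/
lemma inv_one_add_smul_of_mul_self_eq_zero {n : ℕ} {M : Matrix (Fin n) (Fin n) ℝ}
    (hM2 : M * M = 0) (t : ℝ) : (1 + t • M)⁻¹ = 1 - t • M := by
  apply Matrix.inv_eq_right_inv
  simp [mul_sub, add_mul, hM2]

lemma trace_eq_zero_of_mul_self_eq_zero {n : ℕ} {M : Matrix (Fin n) (Fin n) ℝ}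
    (hM2 : M * M = 0) : trace M = 0 :=
  (Matrix.isNilpotent_trace_of_isNilpotent ⟨2, by rw [pow_two, hM2]⟩).eq_zero

lemma hsNorm_sq {n : ℕ} (X : Matrix (Fin n) (Fin n) ℝ) :
    hsNorm X ^ 2 = trace (X * Xᵀ) := by
  apply Real.sq_sqrt
  have h := (Matrix.posSemidef_self_mul_conjTranspose X).trace_nonneg
  simpa using h

lemma hsNorm_pos {n : ℕ} {X : Matrix (Fin n) (Fin n) ℝ} (hX : X ≠ 0) : 0 < hsNorm X := by
  have h0 : 0 ≤ hsNorm X := Real.sqrt_nonneg _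
  refine h0.lt_of_ne' fun h => hX ?_
  have h2 := hsNorm_sq X
  rw [h, zero_pow two_ne_zero] at h2
  apply Matrix.trace_mul_conjTranspose_self_eq_zero_iff.mp
  simpa using h2.symm

lemma HasDerivAt.matrix_trace_mul {n : ℕ} (X : Matrix (Fin n) (Fin n) ℝ)
    {J : ℝ → Matrix (Fin n) (Fin n) ℝ} {J' : Matrix (Fin n) (Fin n) ℝ} {t : ℝ}
    (h : HasDerivAt J J' t) :
    HasDerivAt (fun s => trace (X * J s)) (trace (X * J')) t :=
  ((Matrix.traceLinearMap (Fin n) ℝ ℝ ∘ₗ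
    LinearMap.mulLeft ℝ X).toContinuousLinearMap.hasFDerivAt (x := J t)).comp_hasDerivAt t h

lemma eq_affine_of_hasDerivAt {E : Type*} [NormedAddCommGroup E] [NormedSpace ℝ E]
    {f f' : ℝ → E} (hf : ∀ t, HasDerivAt f (f' t) t) (hf' : ∀ t, HasDerivAt f' 0 t) (t : ℝ) :
    f t = f 0 + t • f' 0 := by
  have hconst : ∀ s, f' s = f' 0 := fun s =>
    is_const_of_deriv_eq_zero (fun s => (hf' s).differentiableAt) (fun s => (hf' s).deriv) s 0
  have hd : ∀ s, HasDerivAt (fun s => f s - s • f' 0) 0 s := fun s => by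
    refine ((hf s).sub ((hasDerivAt_id s).smul_const (f' 0))).congr_deriv ?_
    rw [hconst s, one_smul, sub_self]
  have := is_const_of_deriv_eq_zero (fun s => (hd s).differentiableAt) (fun s => (hd s).deriv) t 0
  simp only [zero_smul, sub_zero] at this
  exact sub_eq_iff_eq_add.mp this

lemma hasDerivAt_arctan_profile {ν h : ℝ} (hν : 0 < ν) (hh : 0 < h) (b₀ b₁ t : ℝ) :
    HasDerivAt (fun s => √ν * b₁ / h * Real.arctan (h * s / √ν) + b₀)
      (ν * b₁ / (ν + h ^ 2 * t ^ 2)) t := by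
  have hr : 0 < √ν := Real.sqrt_pos.mpr hν
  have h1 : HasDerivAt (fun s : ℝ => h * s / √ν) (h / √ν) t := by
    simpa using ((hasDerivAt_id t).const_mul h).div_const (√ν)
  refine ((h1.arctan.const_mul (√ν * b₁ / h)).add_const b₀).congr_deriv ?_
  have hsq : √ν ^ 2 = ν := Real.sq_sqrt hν.le
  rw [div_pow, hsq, mul_pow]
  have : 0 < ν + h ^ 2 * t ^ 2 := by positivity
  field_simp

lemma hasDerivAt_profile_deriv {ν h : ℝ} (hν : 0 < ν) (b₁ t : ℝ) :
    HasDerivAt (fun s => ν * b₁ / (ν + h ^ 2 * s ^ 2))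
      (-(2 * h ^ 2 * t * (ν * b₁)) / (ν + h ^ 2 * t ^ 2) ^ 2) t := by
  have hpos : ν + h ^ 2 * t ^ 2 ≠ 0 := by positivity
  have h1 : HasDerivAt (fun s : ℝ => ν + h ^ 2 * s ^ 2) (h ^ 2 * (2 * t)) t := by
    simpa using ((hasDerivAt_pow 2 t).const_mul (h ^ 2)).const_add ν
  refine ((hasDerivAt_const t (ν * b₁)).div h1 hpos).congr_deriv ?_
  ring

lemma hasDerivAt_smul_affine {E : Type*} [NormedAddCommGroup E] [NormedSpace ℝ E]
    {b : ℝ → ℝ} {b' t : ℝ} (hb : HasDerivAt b b' t) (k ν : ℝ) (P Q : E) :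
    HasDerivAt (fun s => b s • ((k * s / ν) • P + Q))
      (b' • ((k * t / ν) • P + Q) + (b t * (k / ν)) • P) t := by
  have h1 : HasDerivAt (fun s : ℝ => k * s / ν) (k / ν) t := by
    simpa using ((hasDerivAt_id t).const_mul k).div_const ν
  refine (hb.smul ((h1.smul_const P).add_const Q)).congr_deriv ?_
  rw [smul_smul, add_comm]

lemma hasDerivAt_deriv_smul_affine {E : Type*} [NormedAddCommGroup E] [NormedSpace ℝ E]
    {b b' : ℝ → ℝ} {b'' t : ℝ} (hb : HasDerivAt b (b' t) t) (hb' : HasDerivAt b' b'' t)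
    (k ν : ℝ) (P Q : E) :
    HasDerivAt (fun s => b' s • ((k * s / ν) • P + Q) + (b s * (k / ν)) • P)
      (b'' • ((k * t / ν) • P + Q) + (2 * b' t * (k / ν)) • P) t := by
  refine ((hasDerivAt_smul_affine hb' k ν P Q).add
    ((hb.mul_const (k / ν)).smul_const P)).congr_deriv ?_
  module

/-- If `b` has derivative `νb₁/(ν + h²t²)`, the second derivative of `b(t)((h²t/ν)P + Q)`
is a multiple of `P - tQ`. -/
lemma profile_second_deriv_eq {E : Type*} [AddCommGroup E] [Module ℝ E]
    {ν h : ℝ} (hν : 0 < ν) (b₁ t : ℝ) (P Q : E) :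
    (-(2 * h ^ 2 * t * (ν * b₁)) / (ν + h ^ 2 * t ^ 2) ^ 2) • ((h ^ 2 * t / ν) • P + Q) +
        (2 * (ν * b₁ / (ν + h ^ 2 * t ^ 2)) * (h ^ 2 / ν)) • P =
      (2 * h ^ 2 * (ν * b₁) / (ν + h ^ 2 * t ^ 2) ^ 2) • (P - t • Q) := by
  have hpos : ν + h ^ 2 * t ^ 2 ≠ 0 := by positivity
  match_scalars
  · field_simp
    ring
  · field_simp

/-- The solutions of `(ν + h²t²)S'' + 2h²tS' = 0` are the arctangent profiles. -/
lemma eq_arctan_profile {ν h : ℝ} (hν : 0 < ν) (hh : 0 < h) {S S' S'' : ℝ → ℝ}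
    (hS : ∀ t, HasDerivAt S (S' t) t) (hS' : ∀ t, HasDerivAt S' (S'' t) t)
    (hode : ∀ t, (ν + h ^ 2 * t ^ 2) * S'' t + 2 * h ^ 2 * t * S' t = 0) (t : ℝ) :
    S t = √ν * S' 0 / h * Real.arctan (h * t / √ν) + S 0 := by
  have hw : ∀ s, HasDerivAt (fun s => (ν + h ^ 2 * s ^ 2) * S' s) 0 s := fun s => by
    have h1 : HasDerivAt (fun s : ℝ => ν + h ^ 2 * s ^ 2) (h ^ 2 * (2 * s)) s := by
      simpa using ((hasDerivAt_pow 2 s).const_mul (h ^ 2)).const_add ν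
    refine (h1.mul (hS' s)).congr_deriv ?_
    linear_combination hode s
  have hc : ∀ s, S' s = ν * S' 0 / (ν + h ^ 2 * s ^ 2) := fun s => by
    have h1 := is_const_of_deriv_eq_zero (fun s => (hw s).differentiableAt)
      (fun s => (hw s).deriv) s 0
    have hpos : ν + h ^ 2 * s ^ 2 ≠ 0 := by positivity
    rw [eq_div_iff hpos]
    linear_combination h1
  have hd : ∀ s, HasDerivAt
      (fun s => S s - (√ν * S' 0 / h * Real.arctan (h * s / √ν) + S 0)) 0 s := fun s =>
    ((hS s).sub (hasDerivAt_arctan_profile hν hh (S 0) (S' 0) s)).congr_deriv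
      (sub_eq_zero.mpr (hc s))
  have h1 := is_const_of_deriv_eq_zero (fun s => (hd s).differentiableAt)
    (fun s => (hd s).deriv) t 0
  simp only [mul_zero, zero_div, Real.arctan_zero, zero_add, sub_self] at h1
  exact sub_eq_zero.mp h1

/-- explicit form of all Jacobi fields along the linear geodesic
`A(t) = I + tM` where `M ≠ 0` and `M² = 0`. -/
theorem statement_14 {n : ℕ} (M : Matrix (Fin n) (Fin n) ℝ)
    (hMne : M ≠ 0) (hM2 : M * M = 0)
    (J : ℝ → Matrix (Fin n) (Fin n) ℝ)
    (hJd1 : ∀ t, DifferentiableAt ℝ J t) (hJd2 : ∀ t, DifferentiableAt ℝ (deriv J) t) :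
    IsJacobiField (fun t => 1 + t • M) J ↔
      ∃ (b₀ b₁ : ℝ) (K₀ K₁ : Matrix (Fin n) (Fin n) ℝ),
        Matrix.trace K₀ = 0 ∧ Matrix.trace K₁ = 0 ∧
        Matrix.trace (K₀ * M) = 0 ∧ Matrix.trace (K₁ * M) = 0 ∧
        ∀ t : ℝ, J t =
          (Real.sqrt n * b₁ / hsNorm M * Real.arctan (hsNorm M * t / Real.sqrt n) + b₀) •
            ((hsNorm M ^ 2 * t / n) • (1 : Matrix (Fin n) (Fin n) ℝ) + Mᵀ) +
          K₀ + t • K₁ := by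
  have hν : (0 : ℝ) < n := by
    rcases Nat.eq_zero_or_pos n with rfl | hn
    · exact absurd (Subsingleton.elim M 0) hMne
    · exact_mod_cast hn
  have hh := hsNorm_pos hMne
  have hsq := hsNorm_sq M
  have htr := trace_eq_zero_of_mul_self_eq_zero hM2
  set h := hsNorm M
  simp only [IsJacobiField, inv_one_add_smul_of_mul_self_eq_zero hM2, transpose_sub,
    transpose_one, transpose_smul, sub_mul, one_mul, smul_mul_assoc, trace_sub, trace_smul,
    smul_eq_mul]
  constructor
  · rintro ⟨-, -, htan, hjac⟩
    have hJ : ∀ t, HasDerivAt J (deriv J t) t := fun t => (hJd1 t).hasDerivAt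
    have hJ' : ∀ t, HasDerivAt (deriv J) (deriv (deriv J) t) t := fun t => (hJd2 t).hasDerivAt
    have hS := fun t => (hJ t).matrix_trace_mul M
    have hS' := fun t => (hJ' t).matrix_trace_mul M
    have hT := fun t => (hJ t).matrix_trace_mul 1
    have hT' := fun t => (hJ' t).matrix_trace_mul 1
    simp only [one_mul] at hT hT'
    have hT1 : ∀ t, trace (deriv J t) = trace (M * J t) + t * trace (M * deriv J t) := fun t => by
      have h1 := (hasDerivAt_id t).mul (hS t)
      have h2 : (fun s => trace (J s)) = id * fun s => trace (M * J s) :=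
        funext fun s => sub_eq_zero.mp (htan s)
      rw [← h2] at h1
      simpa using (hT t).unique h1
    have hT2 : ∀ t, trace (deriv (deriv J) t) =
        2 * trace (M * deriv J t) + t * trace (M * deriv (deriv J) t) := fun t => by
      have h1 := (hS t).add ((hasDerivAt_id t).mul (hS' t))
      have h2 : (fun s => trace (deriv J s)) =
          (fun s => trace (M * J s)) + id * fun s => trace (M * deriv J s) := funext hT1
      rw [← h2] at h1
      have := (hT' t).unique h1
      simp only [id] at this
      linear_combination this
    have hscal : ∀ t, ∃ c : ℝ, deriv (deriv J) t = c • (1 - t • Mᵀ) ∧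
        trace (M * deriv (deriv J) t) = -(c * t * h ^ 2) ∧
        c * (n + h ^ 2 * t ^ 2) = 2 * trace (M * deriv J t) := fun t => by
      obtain ⟨c, hc⟩ := hjac t
      have e1 : trace (M * deriv (deriv J) t) = -(c * t * h ^ 2) := by
        rw [hc]
        simp only [mul_smul_comm, mul_sub, mul_one, trace_smul, trace_sub, htr, ← hsq, smul_eq_mul]
        ring
      have e2 : trace (deriv (deriv J) t) = c * n := by
        rw [hc]
        simp [htr]
      exact ⟨c, hc, e1, by linear_combination hT2 t - e2 + t * e1⟩
    have hprof := eq_arctan_profile hν hh hS hS' fun t => by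
      obtain ⟨c, -, e1, e2⟩ := hscal t
      rw [e1]
      linear_combination -t * h ^ 2 * e2
    set S₀ := trace (M * J 0)
    set S₁ := trace (M * deriv J 0)
    let b : ℝ → ℝ := fun t => trace (M * J t) / h ^ 2
    have hb : ∀ t, HasDerivAt b (trace (M * deriv J t) / h ^ 2) t := fun t =>
      (hS t).div_const _
    have hb' : ∀ t, HasDerivAt (fun t => trace (M * deriv J t) / h ^ 2)
        (trace (M * deriv (deriv J) t) / h ^ 2) t := fun t => (hS' t).div_const _
    have hL := fun t => (hJ t).sub (hasDerivAt_smul_affine (hb t) (h ^ 2) n 1 Mᵀ)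
    have hL' := fun t => (hJ' t).sub
      (hasDerivAt_deriv_smul_affine (hb t) (hb' t) (h ^ 2) n 1 Mᵀ)
    have haff := eq_affine_of_hasDerivAt hL fun t => by
      refine (hL' t).congr_deriv ?_
      obtain ⟨c, e0, e1, e2⟩ := hscal t
      have e3 : trace (M * deriv J t) = c * (n + h ^ 2 * t ^ 2) / 2 := by linarith
      rw [e1, e3, e0]
      match_scalars
      · field_simp
        ring
      · field_simp
        ring
    have htan0 := htan 0
    have hT10 := hT1 0
    rw [zero_mul, sub_zero] at htan0
    rw [zero_mul, add_zero] at hT10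
    refine ⟨S₀ / h ^ 2, S₁ / h ^ 2, J 0 - b 0 • ((h ^ 2 * 0 / n) • 1 + Mᵀ),
      deriv J 0 - ((S₁ / h ^ 2) • ((h ^ 2 * 0 / n) • 1 + Mᵀ) + (b 0 * (h ^ 2 / n)) • 1),
      ?_, ?_, ?_, ?_, fun t => ?_⟩
    · simp [htan0, htr]
    · simp only [trace_sub, trace_add, trace_smul, trace_transpose, htr, hT10, trace_one,
        Fintype.card_fin, smul_eq_mul, b]
      field_simp
      ring
    · rw [trace_mul_comm]
      simp only [mul_sub, mul_add, mul_smul_comm, mul_one, trace_sub, trace_add, trace_smul, htr,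
        ← hsq, smul_eq_mul, b]
      field_simp
      ring
    · rw [trace_mul_comm]
      simp only [mul_sub, mul_add, mul_smul_comm, mul_one, trace_sub, trace_add, trace_smul, htr,
        ← hsq, smul_eq_mul, b]
      field_simp
      ring
    · have hbt : b t = √n * (S₁ / h ^ 2) / h * Real.arctan (h * t / √n) + S₀ / h ^ 2 := by
        simp only [b, hprof t]
        ring
      rw [← hbt, add_assoc, add_comm]
      exact sub_eq_iff_eq_add.mp (haff t)
  · rintro ⟨b₀, b₁, K₀, K₁, hK₀, hK₁, hK₀M, hK₁M, hform⟩
    rw [trace_mul_comm] at hK₀M hK₁M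
    refine ⟨hJd1, hJd2, fun t => ?_, fun t => ?_⟩
    · rw [hform t]
      simp only [mul_add, mul_smul_comm, mul_one, trace_add, trace_smul, trace_transpose, htr, hK₀,
        hK₁, hK₀M, hK₁M, ← hsq, trace_one, Fintype.card_fin, smul_eq_mul]
      field_simp
      ring
    · have hβ := hasDerivAt_arctan_profile hν hh b₀ b₁
      have hβ' := hasDerivAt_profile_deriv (h := h) hν b₁
      have h1 : deriv J = fun s => (n * b₁ / (n + h ^ 2 * s ^ 2)) •
          ((h ^ 2 * s / n) • (1 : Matrix (Fin n) (Fin n) ℝ) + Mᵀ) +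
          ((√n * b₁ / h * Real.arctan (h * s / √n) + b₀) * (h ^ 2 / n)) • 1 +
          (1 : ℝ) • K₁ := funext fun s => by
        rw [funext hform]
        exact (((hasDerivAt_smul_affine (hβ s) (h ^ 2) n 1 Mᵀ).add_const K₀).add
          ((hasDerivAt_id s).smul_const K₁)).deriv
      refine ⟨2 * h ^ 2 * (n * b₁) / (n + h ^ 2 * t ^ 2) ^ 2, ?_⟩
      rw [h1, ← profile_second_deriv_eq hν]
      exact ((hasDerivAt_deriv_smul_affine (hβ t) (hβ' t) (h ^ 2) n 1 Mᵀ).add_const _).deriv
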